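/- Assume β̃ > 0, let σ be a real m×m matrix, let η be a finite Borel measure on ℝ^m, and let p > 1 satisfy ∫_{{|y|>1}} |y|^p η(dy) < ∞. Then there exist δ ∈ (0,1], a positive constant C̃₀, and a compact set K ⊂ ℝ^m such that ℒ^u 𝒱_{p,δ}(x) + 𝔍_η 𝒱_{p,δ}(x) ≤ C̃₀ 1_K(x) - p δ (β̃/(2m)) 𝒱_{p-1,δ}(x) for all x ∈ ℝ^m and all u ∈ Δ. -/

import Mathlib

open scoped BigOperators
open MeasureTheory

noncomputable section

/-- The piecewise function `ψ` from Definition 1 of the paper. -/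
def psi (t : ℝ) : ℝ :=
  if t ≤ -1 then -(1/2)
  else if t ≤ 0 then (t+1)^3 - (1/2)*(t+1)^4 - 1/2
  else t

/-- `Ψ(x) = ∑ i, ψ(x_i)/μ_i`. -/
def Psi (m : ℕ) (μ : Fin m → ℝ) (x : Fin m → ℝ) : ℝ := ∑ i, psi (x i) / μ i

/-- `Ψ_δ(x) = ∑ i, ψ(δ x_i)/μ_i`. -/
def Psid (m : ℕ) (μ : Fin m → ℝ) (δ : ℝ) (x : Fin m → ℝ) : ℝ :=
  ∑ i, psi (δ * x i) / μ i

/-- The scaled Lyapunov function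
`𝒱_{p,δ}(x) = (δ² Ψ(-x) + Ψ_δ(x) + m / min_i μ_i)^p`. -/
def Vpd (m : ℕ) (μ : Fin m → ℝ) (δ p : ℝ) (x : Fin m → ℝ) : ℝ :=
  (δ ^ 2 * Psi m μ (-x) + Psid m μ δ x + (m : ℝ) / ⨅ i, μ i) ^ p

/-- The drift `b̃(x,u) = -(β̃/m) M e - M (x - ⟨e,x⟩⁺ u) - ⟨e,x⟩⁺ Γ u`, written
componentwise, where `M = diag(μ)` and `Γ = diag(γ)`. -/
def drift (m : ℕ) (μ γ : Fin m → ℝ) (β : ℝ) (x u : Fin m → ℝ) : Fin m → ℝ :=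
  fun i => -(β / (m : ℝ)) * μ i - μ i * (x i - max (∑ j, x j) 0 * u i)
    - max (∑ j, x j) 0 * (γ i * u i)

/-- `trace(A ∇²f(x)) = ∑ i j, A_{ij} ∂_i ∂_j f(x)`. -/
def traceHess (m : ℕ) (A : Matrix (Fin m) (Fin m) ℝ) (f : (Fin m → ℝ) → ℝ)
    (x : Fin m → ℝ) : ℝ :=
  ∑ i, ∑ j, A i j *
    fderiv ℝ (fun y => fderiv ℝ f y (Pi.single i (1 : ℝ))) x (Pi.single j (1 : ℝ))

/-- The Euclidean norm on `ℝ^m`. -/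
def eucNorm (m : ℕ) (x : Fin m → ℝ) : ℝ := Real.sqrt (∑ i, x i ^ 2)

/-- The jump operator `𝔍_η f(x) = ∫ (f(x+y) - f(x) - ⟨y, ∇f(x)⟩) η(dy)`. -/
def Jeta (m : ℕ) (η : Measure (Fin m → ℝ)) (f : (Fin m → ℝ) → ℝ)
    (x : Fin m → ℝ) : ℝ :=
  ∫ y, (f (x + y) - f x - fderiv ℝ f x y) ∂η

/-! ### The scalar function `psi` and its derivatives -/

lemma glue_deriv {g h g' h' : ℝ → ℝ} {a : ℝ} (hg : ∀ t, HasDerivAt g (g' t) t)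
    (hh : ∀ t, HasDerivAt h (h' t) t) (h0 : g a = h a) (h1 : g' a = h' a) (t : ℝ) :
    HasDerivAt (fun t => if t ≤ a then g t else h t) (if t ≤ a then g' t else h' t) t := by
  rcases lt_trichotomy t a with hlt | heq | hgt
  · rw [if_pos hlt.le]
    refine (hg t).congr_of_eventuallyEq ?_
    filter_upwards [Iio_mem_nhds hlt] with y hy
    rw [if_pos (le_of_lt hy)]
  · subst heq
    rw [if_pos le_rfl]
    have e1 : HasDerivWithinAt (fun s => if s ≤ t then g s else h s) (g' t) (Set.Iic t) t := by
      refine (hg t).hasDerivWithinAt.congr (fun y hy => if_pos hy) (if_pos le_rfl)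
    have e2 : HasDerivWithinAt (fun s => if s ≤ t then g s else h s) (g' t) (Set.Ici t) t := by
      rw [h1]
      refine (hh t).hasDerivWithinAt.congr (fun y hy => ?_) ?_
      · by_cases hy' : y ≤ t
        · have : y = t := le_antisymm hy' hy
          subst this
          simp [h0]
        · simp [hy']
      · simp [h0]
    have := e1.union e2
    rw [Set.Iic_union_Ici] at this
    exact this.hasDerivAt Filter.univ_mem
  · rw [if_neg (not_le.mpr hgt)]
    refine (hh t).congr_of_eventuallyEq ?_
    filter_upwards [Ioi_mem_nhds hgt] with y hy
    rw [if_neg (not_le.mpr hy)]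

def dpsi (t : ℝ) : ℝ :=
  if t ≤ -1 then 0 else if t ≤ 0 then 3 * (t+1)^2 - 2 * (t+1)^3 else 1

def ddpsi (t : ℝ) : ℝ :=
  if t ≤ -1 then 0 else if t ≤ 0 then 6 * (t+1) - 6 * (t+1)^2 else 0

lemma psi_deriv (t : ℝ) : HasDerivAt psi (dpsi t) t := by
  have hp : ∀ t : ℝ, HasDerivAt (fun t : ℝ => (t+1)^3 - (1/2)*(t+1)^4 - 1/2)
      (3 * (t+1)^2 - 2 * (t+1)^3) t := by
    intro t
    have h1 : HasDerivAt (fun t : ℝ => t + 1) 1 t := (hasDerivAt_id t).add_const 1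
    have := ((h1.pow 3).sub ((h1.pow 4).const_mul (1/2))).sub_const (1/2)
    refine HasDerivAt.congr_deriv this ?_
    push_cast; ring
  have h2 := glue_deriv (a := 0) hp (fun t => hasDerivAt_id t) (by norm_num) (by norm_num)
  exact glue_deriv (a := -1) (fun t => hasDerivAt_const t (-(1/2) : ℝ)) h2 (by norm_num)
    (by norm_num) t

lemma dpsi_deriv (t : ℝ) : HasDerivAt dpsi (ddpsi t) t := by
  have hp : ∀ t : ℝ, HasDerivAt (fun t : ℝ => 3 * (t+1)^2 - 2 * (t+1)^3)
      (6 * (t+1) - 6 * (t+1)^2) t := by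
    intro t
    have h1 : HasDerivAt (fun t : ℝ => t + 1) 1 t := (hasDerivAt_id t).add_const 1
    have := (((h1.pow 2).const_mul 3).sub ((h1.pow 3).const_mul 2))
    refine HasDerivAt.congr_deriv this ?_
    push_cast; ring
  have h2 := glue_deriv (a := 0) hp (fun t => hasDerivAt_const t (1:ℝ)) (by norm_num) (by norm_num)
  exact glue_deriv (a := -1) (fun t => hasDerivAt_const t (0 : ℝ)) h2 (by norm_num)
    (by norm_num) t

lemma dpsi_nonneg (t : ℝ) : 0 ≤ dpsi t := by
  unfold dpsi
  split_ifs with h1 h2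
  · exact le_rfl
  · have : 0 ≤ (t+1)^2 * (3 - 2 * (t+1)) := mul_nonneg (sq_nonneg _) (by linarith)
    linarith
  · norm_num

lemma dpsi_le_one (t : ℝ) : dpsi t ≤ 1 := by
  unfold dpsi
  split_ifs with h1 h2
  · norm_num
  · push Not at h1
    have : 0 ≤ t^2 * (2 * t + 3) := mul_nonneg (sq_nonneg _) (by linarith)
    nlinarith
  · norm_num

lemma dpsi_of_nonneg {t : ℝ} (h : 0 ≤ t) : dpsi t = 1 := by
  unfold dpsi
  rw [if_neg (by linarith)]
  split_ifs with h2
  · have : t = 0 := le_antisymm h2 h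
    subst this; norm_num
  · rfl

lemma dpsi_neg_mul {t : ℝ} (h : 0 ≤ t) : dpsi (-t) * t ≤ 1 := by
  by_cases h1 : 1 ≤ t
  · unfold dpsi
    rw [if_pos (by linarith)]; norm_num
  · have := dpsi_le_one (-t)
    have := dpsi_nonneg (-t)
    nlinarith

lemma abs_ddpsi (t : ℝ) : |ddpsi t| ≤ 3/2 := by
  unfold ddpsi
  split_ifs with h1 h2
  · norm_num
  · push Not at h1
    rw [abs_le]
    constructor <;> nlinarith [sq_nonneg (2*(t+1)-1)]
  · norm_num

lemma psi_ge (t : ℝ) : -(1/2) ≤ psi t := by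
  unfold psi
  split_ifs with h1 h2
  · exact le_rfl
  · push Not at h1
    have : 0 ≤ (t+1)^3 * (1 - (1/2) * (t+1)) :=
      mul_nonneg (pow_nonneg (by linarith) _) (by linarith)
    nlinarith
  · linarith

lemma psi_le_abs (t : ℝ) : psi t ≤ |t| := by
  unfold psi
  split_ifs with h1 h2
  · exact le_trans (by norm_num) (abs_nonneg t)
  · push Not at h1
    rw [abs_of_nonpos h2]
    obtain ⟨s, rfl⟩ : ∃ s, t = s - 1 := ⟨t + 1, by ring⟩
    have hs0 : 0 ≤ s := by linarith
    have hs1 : s ≤ 1 := by linarith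
    have : s^3 - (1/2) * s^4 - 1/2 ≤ 0 := by
      have h3 : s^3 ≤ 1 := pow_le_one₀ hs0 hs1
      have h4 : s^4 = s * s^3 := by ring
      have h5 : 0 ≤ s^3 := pow_nonneg hs0 _
      nlinarith [mul_nonneg hs0 (sub_nonneg.mpr hs1), mul_nonneg h5 (sub_nonneg.mpr hs1),
        sq_nonneg (s^2 - s), sq_nonneg (s^2-1), sq_nonneg (s-1), sq_nonneg (s^2-s-1), mul_nonneg (mul_nonneg hs0 hs0) (sub_nonneg.mpr hs1)]
    have e : s - 1 + 1 = s := by ring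
    rw [e]
    linarith
  · exact le_abs_self t

lemma psi_of_nonneg {t : ℝ} (h : 0 ≤ t) : psi t = t := by
  unfold psi
  rw [if_neg (by linarith)]
  split_ifs with h2
  · have : t = 0 := le_antisymm h2 h
    subst this; norm_num
  · rfl

/-! ### The one-dimensional building block -/

def phi (δ t : ℝ) : ℝ := δ^2 * psi (-t) + psi (δ * t)
def dphi (δ t : ℝ) : ℝ := δ * dpsi (δ * t) - δ^2 * dpsi (-t)
def ddphi (δ t : ℝ) : ℝ := δ^2 * ddpsi (δ * t) + δ^2 * ddpsi (-t)

lemma phi_deriv (δ t : ℝ) : HasDerivAt (phi δ) (dphi δ t) t := by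
  have h1 : HasDerivAt (fun t => psi (-t)) (dpsi (-t) * (-1)) t :=
    (psi_deriv (-t)).comp t (hasDerivAt_neg t)
  have h2 : HasDerivAt (fun t => psi (δ * t)) (dpsi (δ * t) * (δ * 1)) t :=
    (psi_deriv (δ * t)).comp t ((hasDerivAt_id t).const_mul δ)
  have := (h1.const_mul (δ^2)).add h2
  refine HasDerivAt.congr_deriv this ?_
  unfold dphi; ring

lemma dphi_deriv (δ t : ℝ) : HasDerivAt (dphi δ) (ddphi δ t) t := by
  have h1 : HasDerivAt (fun t => dpsi (-t)) (ddpsi (-t) * (-1)) t :=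
    (dpsi_deriv (-t)).comp t (hasDerivAt_neg t)
  have h2 : HasDerivAt (fun t => dpsi (δ * t)) (ddpsi (δ * t) * (δ * 1)) t :=
    (dpsi_deriv (δ * t)).comp t ((hasDerivAt_id t).const_mul δ)
  have := (h2.const_mul δ).sub (h1.const_mul (δ^2))
  refine HasDerivAt.congr_deriv this ?_
  unfold ddphi; ring

lemma abs_dphi {δ : ℝ} (h0 : 0 < δ) (h1 : δ ≤ 1) (t : ℝ) : |dphi δ t| ≤ δ := by
  unfold dphi
  have a0 := dpsi_nonneg (δ * t)
  have a1 := dpsi_le_one (δ * t)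
  have b0 := dpsi_nonneg (-t)
  have b1 := dpsi_le_one (-t)
  have hd : δ^2 ≤ δ := by nlinarith
  have h2 : 0 ≤ δ^2 := sq_nonneg δ
  rw [abs_le]
  constructor <;> nlinarith

lemma abs_ddphi (δ t : ℝ) : |ddphi δ t| ≤ 3 * δ^2 := by
  unfold ddphi
  have a := abs_le.mp (abs_ddpsi (δ * t))
  have b := abs_le.mp (abs_ddpsi (-t))
  have h2 : 0 ≤ δ^2 := sq_nonneg δ
  rw [abs_le]
  constructor <;> nlinarith

lemma phi_lip {δ : ℝ} (h0 : 0 < δ) (h1 : δ ≤ 1) (t y : ℝ) :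
    |phi δ (t + y) - phi δ t| ≤ δ * |y| := by
  have := Convex.norm_image_sub_le_of_norm_hasDerivWithin_le (f := phi δ) (f' := dphi δ)
    (s := Set.univ) (x := t) (y := t + y) (C := δ)
    (fun x _ => (phi_deriv δ x).hasDerivWithinAt) (fun x _ => abs_dphi h0 h1 x) convex_univ
    (Set.mem_univ _) (Set.mem_univ _)
  simpa using this

lemma dphi_lip (δ t y : ℝ) : |dphi δ y - dphi δ t| ≤ 3 * δ^2 * |y - t| := by
  have := Convex.norm_image_sub_le_of_norm_hasDerivWithin_le (f := dphi δ) (f' := ddphi δ)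
    (s := Set.univ) (x := t) (y := y) (C := 3 * δ^2)
    (fun x _ => (dphi_deriv δ x).hasDerivWithinAt) (fun x _ => abs_ddphi δ x) convex_univ
    (Set.mem_univ _) (Set.mem_univ _)
  simpa using this

lemma phi_taylor2 (δ t y : ℝ) :
    |phi δ (t + y) - phi δ t - dphi δ t * y| ≤ 3 * δ^2 * |y|^2 := by
  have key := Convex.norm_image_sub_le_of_norm_hasDerivWithin_le
    (f := fun z => phi δ z - dphi δ t * z) (f' := fun z => dphi δ z - dphi δ t)
    (s := Set.uIcc t (t+y)) (x := t) (y := t + y) (C := 3 * δ^2 * |y|)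
    (fun x _ => by
      have := ((phi_deriv δ x).sub ((hasDerivAt_id x).const_mul (dphi δ t))).hasDerivWithinAt
        (s := Set.uIcc t (t+y))
      rw [mul_one] at this
      exact this)
    (fun x hx => by
      refine (dphi_lip δ t x).trans ?_
      have : |x - t| ≤ |y| := by
        have := Set.abs_sub_left_of_mem_uIcc hx
        simpa using this
      have h2 : 0 ≤ δ^2 := sq_nonneg δ
      gcongr)
    (convex_uIcc _ _) Set.left_mem_uIcc Set.right_mem_uIcc
  simp only [Real.norm_eq_abs] at key
  have e : phi δ (t + y) - dphi δ t * (t + y) - (phi δ t - dphi δ t * t)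
    = phi δ (t + y) - phi δ t - dphi δ t * y := by ring
  rw [e] at key
  calc _ ≤ _ := key
    _ = _ := by rw [add_sub_cancel_left]; ring

lemma phi_taylor {δ s : ℝ} (h0 : 0 < δ) (h1 : δ ≤ 1) (hs0 : 0 ≤ s) (hs1 : s ≤ 1) (t y : ℝ) :
    |phi δ (t + y) - phi δ t - dphi δ t * y| ≤ 3 * δ^(1+s) * |y|^(1+s) := by
  rw [mul_assoc, ← Real.mul_rpow h0.le (abs_nonneg y)]
  have hw : 0 ≤ δ * |y| := by positivity
  by_cases hc : δ * |y| ≤ 1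
  · refine (phi_taylor2 δ t y).trans ?_
    have : (δ * |y|)^(2:ℝ) ≤ (δ * |y|)^(1+s) := by
      rcases hw.eq_or_lt with h | h
      · rw [← h, Real.zero_rpow (by norm_num), Real.zero_rpow (by linarith)]
      · exact Real.rpow_le_rpow_of_exponent_ge h hc (by linarith)
    rw [Real.rpow_two] at this
    nlinarith
  · push Not at hc
    have h2 : (δ * |y|)^(1:ℝ) ≤ (δ * |y|)^(1+s) :=
      Real.rpow_le_rpow_of_exponent_le hc.le (by linarith)
    rw [Real.rpow_one] at h2
    have h3 := phi_lip h0 h1 t y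
    have h4 : |dphi δ t * y| ≤ δ * |y| := by
      rw [abs_mul]
      exact mul_le_mul_of_nonneg_right (abs_dphi h0 h1 t) (abs_nonneg y)
    have h5 := abs_sub (phi δ (t + y) - phi δ t) (dphi δ t * y)
    linarith

lemma phi_lower {δ : ℝ} (h0 : 0 < δ) (h1 : δ ≤ 1) (t : ℝ) : δ^2 * |t| - 1/2 ≤ phi δ t := by
  unfold phi
  have hd : δ^2 ≤ δ := by nlinarith
  have h2 : 0 ≤ δ^2 := sq_nonneg δ
  rcases le_total 0 t with h | h
  · rw [psi_of_nonneg (mul_nonneg h0.le h), abs_of_nonneg h]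
    have := psi_ge (-t)
    nlinarith
  · rw [psi_of_nonneg (neg_nonneg.mpr h), abs_of_nonpos h]
    have := psi_ge (δ * t)
    linarith

lemma phi_upper {δ : ℝ} (h0 : 0 < δ) (h1 : δ ≤ 1) (t : ℝ) : phi δ t ≤ 2 * |t| := by
  unfold phi
  have hd : δ^2 ≤ 1 := by nlinarith
  have h2 : 0 ≤ δ^2 := sq_nonneg δ
  have a := psi_le_abs (-t)
  have b := psi_le_abs (δ * t)
  rw [abs_neg] at a
  rw [abs_mul, abs_of_pos h0] at b
  have := abs_nonneg t
  nlinarith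

lemma dphi_mul_1 {δ : ℝ} (h0 : 0 < δ) (x : ℝ) : dphi δ x * (-x) ≤ -(δ * x) + δ^2 := by
  unfold dphi
  have h2 : 0 ≤ δ^2 := sq_nonneg δ
  rcases le_total 0 x with h | h
  · rw [dpsi_of_nonneg (mul_nonneg h0.le h)]
    have := dpsi_neg_mul h
    nlinarith
  · rw [dpsi_of_nonneg (neg_nonneg.mpr h)]
    have := dpsi_le_one (δ * x)
    have h3 : 0 ≤ δ * (-x) := mul_nonneg h0.le (by linarith)
    have h4 : 0 ≤ δ^2 * (-x) := mul_nonneg h2 (by linarith)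
    nlinarith

lemma dphi_mul_2 {δ : ℝ} (h0 : 0 < δ) (h1 : δ ≤ 1) (x : ℝ) :
    dphi δ x * (-x) ≤ 1 + δ^2 - δ^2 * |x| := by
  unfold dphi
  have h2 : 0 ≤ δ^2 := sq_nonneg δ
  have hd : δ^2 ≤ δ := by nlinarith
  rcases le_total 0 x with h | h
  · rw [dpsi_of_nonneg (mul_nonneg h0.le h), abs_of_nonneg h]
    have := dpsi_neg_mul h
    nlinarith
  · rw [dpsi_of_nonneg (neg_nonneg.mpr h), abs_of_nonpos h]
    have h3 : 0 ≤ δ * (-x) := mul_nonneg h0.le (by linarith)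
    have := dpsi_neg_mul h3
    rw [show -(δ * -x) = δ * x by ring] at this
    nlinarith

lemma dphi_mul_c {δ c : ℝ} (h0 : 0 < δ) (h1 : δ ≤ 1) (hc : 0 ≤ c) (hdc : δ * c ≤ 1) (x : ℝ) :
    dphi δ x * (1 - c) ≤ δ := by
  have hh := abs_le.mp (abs_dphi h0 h1 x)
  rcases le_total 0 (dphi δ x) with h | h
  · nlinarith
  · have : -δ^2 ≤ dphi δ x := by
      unfold dphi
      have a0 := mul_nonneg h0.le (dpsi_nonneg (δ * x))
      have b1 := dpsi_le_one (-x)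
      have h2 : 0 ≤ δ^2 := sq_nonneg δ
      nlinarith
    nlinarith

/-! ### Power estimates -/

lemma pow_tangent {p A B : ℝ} (hp : 1 ≤ p) (hA : 0 < A) (hB : 0 < B) :
    A^p - B^p ≤ p * A^(p-1) * (A - B) := by
  have h := one_add_mul_self_le_rpow_one_add (s := B / A - 1) (p := p)
    (by have : 0 < B / A := by positivity
        linarith) hp
  rw [show 1 + (B / A - 1) = B / A by ring, Real.div_rpow hB.le hA.le] at h
  have hAp : 0 < A^p := Real.rpow_pos_of_pos hA p
  rw [le_div_iff₀ hAp] at h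
  have e : A^(p-1) = A^p / A := by rw [Real.rpow_sub hA, Real.rpow_one]
  rw [e]
  have : p * (A^p / A) * (A - B) = A^p - (1 + p * (B / A - 1)) * A^p := by
    field_simp; ring
  linarith

lemma pow_diff_aux_small {p A B : ℝ} (hp : 1 < p) (hp2 : p ≤ 2) (hB : 0 < B) (hAB : B ≤ A) :
    (A^(p-1) - B^(p-1)) * (A - B) ≤ (1 + |A - B|)^p := by
  have h := Real.rpow_add_le_add_rpow (p := p - 1) hB.le (sub_nonneg.mpr hAB) (by linarith)
    (by linarith)
  rw [add_sub_cancel] at h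
  have hn : 0 ≤ A - B := sub_nonneg.mpr hAB
  rw [abs_of_nonneg hn]
  have h3 : (A - B)^(p-1) ≤ (1 + (A - B))^(p-1) :=
    Real.rpow_le_rpow hn (by linarith) (by linarith)
  have e : (1 + (A - B))^p = (1 + (A - B))^(p-1) * (1 + (A - B)) := by
    rw [← Real.rpow_add_one (by linarith)]; congr 1; ring
  rw [e]
  have h4 : 0 ≤ (1 + (A - B))^(p-1) := Real.rpow_nonneg (by linarith) _
  exact mul_le_mul (by linarith) (by linarith) hn h4

lemma pow_diff_aux_big {p g A B M : ℝ} (hp : 2 ≤ p) (hB : 0 < B) (hAB : B ≤ A)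
    (hg : 0 < g) (hM : g ≤ M) (hAM : A ≤ M + (A - B)) :
    (A^(p-1) - B^(p-1)) * (A - B) ≤
      (p-1) * (1 + 1/g)^(p-2) * M^(p-2) * (1 + |A - B|)^p := by
  have hA : 0 < A := by linarith
  have h := pow_tangent (p := p - 1) (by linarith) hA hB
  rw [show p - 1 - 1 = p - 2 by ring] at h
  have hn : 0 ≤ A - B := sub_nonneg.mpr hAB
  rw [abs_of_nonneg hn]
  have hM0 : 0 < M := by linarith
  have k1 : A ≤ (1 + 1/g) * M * (1 + (A - B)) := by
    have : 1 ≤ (1/g) * M := by rw [one_div_mul_eq_div, le_div_iff₀ hg]; linarith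
    have h5 : M + (A - B) ≤ (1 + 1/g) * M + (1 + 1/g) * M * (A - B) := by
      have : 1 ≤ (1 + 1/g) * M := by nlinarith
      have h6 : 0 ≤ (1/g) * M := by positivity
      nlinarith
    linarith
  have k2 : A^(p-2) ≤ (1 + 1/g)^(p-2) * M^(p-2) * (1 + (A - B))^(p-2) := by
    rw [← Real.mul_rpow (by positivity) hM0.le, ← Real.mul_rpow (by positivity) (by linarith)]
    exact Real.rpow_le_rpow hA.le k1 (by linarith)
  have e : (1 + (A - B))^p = (1 + (A - B))^(p-2) * (1 + (A - B))^2 := by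
    rw [← Real.rpow_two, ← Real.rpow_add (by linarith)]; congr 1; ring
  rw [e]
  have hA2 : 0 ≤ A^(p-2) := Real.rpow_nonneg hA.le _
  have hsq : (A - B)^2 ≤ (1 + (A - B))^2 := by nlinarith
  calc (A^(p-1) - B^(p-1)) * (A - B) ≤ ((p-1) * A^(p-2) * (A - B)) * (A - B) :=
        mul_le_mul_of_nonneg_right h hn
    _ = (p-1) * (A^(p-2) * (A - B)^2) := by ring
    _ ≤ (p-1) * (((1 + 1/g)^(p-2) * M^(p-2) * (1 + (A - B))^(p-2)) * (1 + (A - B))^2) := by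
        refine mul_le_mul_of_nonneg_left ?_ (by linarith)
        exact mul_le_mul k2 hsq (sq_nonneg _) (hA2.trans k2)
    _ = _ := by ring

lemma pow_rem {p g : ℝ} (hp : 1 < p) (hg : 0 < g) : ∃ C : ℝ, 0 ≤ C ∧ ∀ A B : ℝ, g ≤ A → g ≤ B →
    A^p - B^p - p * B^(p-1) * (A - B) ≤ C * (B^(p-2) + 1) * (1 + |A - B|)^p := by
  have red : ∀ A B : ℝ, g ≤ A → g ≤ B → A^p - B^p - p * B^(p-1) * (A - B) ≤
      p * ((A^(p-1) - B^(p-1)) * (A - B)) := by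
    intro A B hA hB
    have := pow_tangent hp.le (lt_of_lt_of_le hg hA) (lt_of_lt_of_le hg hB)
    linarith
  rcases le_total p 2 with h2 | h2
  · refine ⟨p, by linarith, fun A B hA hB => (red A B hA hB).trans ?_⟩
    have hA0 : 0 < A := by linarith
    have hB0 : 0 < B := by linarith
    have key : (A^(p-1) - B^(p-1)) * (A - B) ≤ (1 + |A - B|)^p := by
      rcases le_total B A with h | h
      · exact pow_diff_aux_small hp h2 hB0 h
      · have := pow_diff_aux_small hp h2 hA0 h
        rw [abs_sub_comm]; linarith
    have h3 : 0 ≤ B^(p-2) := Real.rpow_nonneg hB0.le _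
    have h4 : 0 ≤ (1 + |A - B|)^p := Real.rpow_nonneg (by positivity) _
    rw [mul_assoc]
    refine mul_le_mul_of_nonneg_left ?_ (by linarith)
    nlinarith
  · have hk : 0 ≤ (1 + 1/g)^(p-2) := Real.rpow_nonneg (by positivity) _
    refine ⟨p * ((p-1) * (1 + 1/g)^(p-2)), mul_nonneg (by linarith) (mul_nonneg (by linarith) hk),
      fun A B hA hB => (red A B hA hB).trans ?_⟩
    have hA0 : 0 < A := by linarith
    have hB0 : 0 < B := by linarith
    have key : (A^(p-1) - B^(p-1)) * (A - B) ≤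
        (p-1) * (1 + 1/g)^(p-2) * B^(p-2) * (1 + |A - B|)^p := by
      rcases le_total B A with h | h
      · exact pow_diff_aux_big h2 hB0 h hg hB (by linarith)
      · have := pow_diff_aux_big h2 hA0 h hg hB (by linarith)
        rw [abs_sub_comm]; linarith
    have h3 : 0 ≤ B^(p-2) := Real.rpow_nonneg hB0.le _
    have h4 : 0 ≤ (1 + |A - B|)^p := Real.rpow_nonneg (by positivity) _
    rw [mul_assoc, mul_assoc]
    refine mul_le_mul_of_nonneg_left (key.trans ?_) (by linarith)
    have h5 : 0 ≤ (p-1) * (1 + 1/g)^(p-2) := mul_nonneg (by linarith) hk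
    rw [mul_assoc ((p-1) * (1 + 1/g)^(p-2))]
    refine mul_le_mul_of_nonneg_left ?_ h5
    nlinarith

lemma low_order {p ε : ℝ} (hp : 1 < p) (hε : 0 < ε) :
    ∃ B0 : ℝ, ∀ B, B0 ≤ B → B^(p-2) + 1 ≤ ε * B^(p-1) := by
  have ht := (tendsto_rpow_atTop (y := p - 1) (by linarith)).eventually_ge_atTop (2/ε)
  obtain ⟨b, hb⟩ := Filter.eventually_atTop.mp ht
  refine ⟨max b (max (2/ε) 1), fun B hB => ?_⟩
  have h1 := hb B ((le_max_left _ _).trans hB)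
  have h2 : 2/ε ≤ B := (le_max_left _ _).trans ((le_max_right _ _).trans hB)
  have h3 : 1 ≤ B := (le_max_right _ _).trans ((le_max_right _ _).trans hB)
  have hB0 : 0 < B := by linarith
  have e : B^(p-1) = B^(p-2) * B := by
    rw [← Real.rpow_add_one hB0.ne']; congr 1; ring
  rw [div_le_iff₀ hε] at h1 h2
  have h4 : 0 ≤ B^(p-2) := Real.rpow_nonneg hB0.le _
  have : 2 * B^(p-2) ≤ ε * B^(p-1) := by rw [e]; nlinarith
  linarith

/-! ### The base function of `Vpd` -/

def GG (m : ℕ) (μ : Fin m → ℝ) (δ : ℝ) (x : Fin m → ℝ) : ℝ :=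
  ∑ i, phi δ (x i) / μ i + (m : ℝ) / ⨅ i, μ i

def dGG (m : ℕ) (μ : Fin m → ℝ) (δ : ℝ) (x v : Fin m → ℝ) : ℝ :=
  ∑ i, dphi δ (x i) / μ i * v i

lemma Vpd_eq (m : ℕ) (μ : Fin m → ℝ) (δ p : ℝ) (x : Fin m → ℝ) :
    Vpd m μ δ p x = GG m μ δ x ^ p := by
  unfold Vpd GG Psi Psid phi
  congr 2
  rw [Finset.mul_sum, ← Finset.sum_add_distrib]
  refine Finset.sum_congr rfl fun i _ => ?_
  rw [Pi.neg_apply]; ring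

lemma iInf_mu_pos {m : ℕ} (hm : 1 ≤ m) {μ : Fin m → ℝ} (hμ : ∀ i, 0 < μ i) : 0 < ⨅ i, μ i := by
  have : Nonempty (Fin m) := ⟨⟨0, hm⟩⟩
  obtain ⟨i, hi⟩ := exists_eq_ciInf_of_finite (f := μ)
  rw [← hi]; exact hμ i

lemma inv_mu_le {m : ℕ} (hm : 1 ≤ m) {μ : Fin m → ℝ} (hμ : ∀ i, 0 < μ i) (i : Fin m) :
    1 / μ i ≤ 1 / ⨅ i, μ i :=
  one_div_le_one_div_of_le (iInf_mu_pos hm hμ) (ciInf_le (Set.finite_range μ).bddBelow i)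

lemma GG_lower {m : ℕ} (hm : 1 ≤ m) {μ : Fin m → ℝ} (hμ : ∀ i, 0 < μ i) {δ : ℝ} (h0 : 0 < δ)
    (h1 : δ ≤ 1) (x : Fin m → ℝ) :
    (m : ℝ) / (⨅ i, μ i) / 2 + ∑ i, δ^2 * |x i| / μ i ≤ GG m μ δ x := by
  unfold GG
  have a : ∑ i, (δ^2 * |x i| / μ i - (1 / ⨅ i, μ i) / 2) ≤ ∑ i, phi δ (x i) / μ i := by
    refine Finset.sum_le_sum fun i _ => ?_
    have h := div_le_div_of_nonneg_right (phi_lower h0 h1 (x i)) (hμ i).le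
    have h2 := inv_mu_le hm hμ i
    rw [sub_div] at h
    have e : 1 / 2 / μ i = (1 / μ i) / 2 := by ring
    rw [e] at h
    linarith
  rw [Finset.sum_sub_distrib] at a
  simp only [Finset.sum_const, Finset.card_univ, Fintype.card_fin, nsmul_eq_mul] at a
  have e : (m : ℝ) * ((1 / ⨅ i, μ i) / 2) = (m : ℝ) / (⨅ i, μ i) / 2 := by ring
  rw [e] at a
  linarith

lemma GG_ge {m : ℕ} (hm : 1 ≤ m) {μ : Fin m → ℝ} (hμ : ∀ i, 0 < μ i) {δ : ℝ} (h0 : 0 < δ)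
    (h1 : δ ≤ 1) (x : Fin m → ℝ) :
    (m : ℝ) / (⨅ i, μ i) / 2 ≤ GG m μ δ x := by
  refine le_trans ?_ (GG_lower hm hμ h0 h1 x)
  have : 0 ≤ ∑ i, δ^2 * |x i| / μ i := Finset.sum_nonneg fun i _ => by
    have := hμ i
    positivity
  linarith

lemma g0_pos {m : ℕ} (hm : 1 ≤ m) {μ : Fin m → ℝ} (hμ : ∀ i, 0 < μ i) :
    0 < (m : ℝ) / (⨅ i, μ i) / 2 := by
  have := iInf_mu_pos hm hμ
  have : (0:ℝ) < m := by exact_mod_cast hm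
  positivity

lemma GG_pos {m : ℕ} (hm : 1 ≤ m) {μ : Fin m → ℝ} (hμ : ∀ i, 0 < μ i) {δ : ℝ} (h0 : 0 < δ)
    (h1 : δ ≤ 1) (x : Fin m → ℝ) : 0 < GG m μ δ x :=
  lt_of_lt_of_le (g0_pos hm hμ) (GG_ge hm hμ h0 h1 x)

lemma GG_hasFDerivAt (m : ℕ) (μ : Fin m → ℝ) (δ : ℝ) (x : Fin m → ℝ) :
    HasFDerivAt (GG m μ δ)
      (∑ i, (dphi δ (x i) / μ i) • (ContinuousLinearMap.proj i : (Fin m → ℝ) →L[ℝ] ℝ)) x := by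
  have h : ∀ i ∈ (Finset.univ : Finset (Fin m)), HasFDerivAt (fun y : Fin m → ℝ => phi δ (y i) / μ i)
      ((dphi δ (x i) / μ i) • (ContinuousLinearMap.proj i : (Fin m → ℝ) →L[ℝ] ℝ)) x := by
    intro i _
    have h1 : HasDerivAt (fun t => phi δ t / μ i) (dphi δ (x i) / μ i) (x i) :=
      (phi_deriv δ (x i)).div_const _
    exact h1.comp_hasFDerivAt x (ContinuousLinearMap.proj i : (Fin m → ℝ) →L[ℝ] ℝ).hasFDerivAt
  have := (HasFDerivAt.fun_sum h).add_const ((m : ℝ) / ⨅ i, μ i)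
  exact this

lemma GGpow_hasFDerivAt {m : ℕ} {μ : Fin m → ℝ} {δ : ℝ} {x : Fin m → ℝ}
    (hx : 0 < GG m μ δ x) (q : ℝ) :
    HasFDerivAt (fun y => GG m μ δ y ^ q) ((q * GG m μ δ x ^ (q - 1)) •
      (∑ i, (dphi δ (x i) / μ i) • (ContinuousLinearMap.proj i : (Fin m → ℝ) →L[ℝ] ℝ))) x :=
  (Real.hasDerivAt_rpow_const (Or.inl hx.ne')).comp_hasFDerivAt x (GG_hasFDerivAt m μ δ x)

lemma fderiv_Vpd {m : ℕ} {μ : Fin m → ℝ} {δ : ℝ} {x : Fin m → ℝ}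
    (hx : 0 < GG m μ δ x) (p : ℝ) (v : Fin m → ℝ) :
    fderiv ℝ (Vpd m μ δ p) x v = p * GG m μ δ x ^ (p-1) * dGG m μ δ x v := by
  have e : Vpd m μ δ p = fun y => GG m μ δ y ^ p := funext fun y => Vpd_eq m μ δ p y
  rw [e, (GGpow_hasFDerivAt hx p).fderiv]
  simp [dGG]

lemma dGG_single (m : ℕ) (μ : Fin m → ℝ) (δ : ℝ) (x : Fin m → ℝ) (i : Fin m) :
    dGG m μ δ x (Pi.single i 1) = dphi δ (x i) / μ i := by
  unfold dGG
  simp [Pi.single_apply]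

lemma hess_Vpd {m : ℕ} {μ : Fin m → ℝ} {δ : ℝ} (hpos : ∀ x, 0 < GG m μ δ x) (p : ℝ)
    (x : Fin m → ℝ) (i j : Fin m) :
    fderiv ℝ (fun y => fderiv ℝ (Vpd m μ δ p) y (Pi.single i (1 : ℝ))) x (Pi.single j (1 : ℝ)) =
      p * (p-1) * GG m μ δ x ^ (p-2) * (dphi δ (x j) / μ j) * (dphi δ (x i) / μ i)
      + p * GG m μ δ x ^ (p-1) * (if i = j then ddphi δ (x i) / μ i else 0) := by
  have e : (fun y => fderiv ℝ (Vpd m μ δ p) y (Pi.single i (1 : ℝ))) =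
      fun y => (p * GG m μ δ y ^ (p-1)) * (dphi δ (y i) / μ i) := by
    funext y
    rw [fderiv_Vpd (hpos y), dGG_single]
  have h1 : HasDerivAt (fun t => dphi δ t / μ i) (ddphi δ (x i) / μ i) (x i) :=
    (dphi_deriv δ (x i)).div_const _
  have hproj : HasFDerivAt (fun y : Fin m → ℝ => y i)
      (ContinuousLinearMap.proj i : (Fin m → ℝ) →L[ℝ] ℝ) x :=
    (ContinuousLinearMap.proj i : (Fin m → ℝ) →L[ℝ] ℝ).hasFDerivAt
  have h2 : HasFDerivAt (fun y : Fin m → ℝ => dphi δ (y i) / μ i)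
      ((ddphi δ (x i) / μ i) • (ContinuousLinearMap.proj i : (Fin m → ℝ) →L[ℝ] ℝ)) x := by
    have h2' := HasDerivAt.comp_hasFDerivAt (f := fun y : Fin m → ℝ => y i) x h1 hproj
    exact h2'
  have h3 := ((GGpow_hasFDerivAt (hpos x) (p-1)).const_mul p).mul h2
  have h4 := dGG_single m μ δ x j
  unfold dGG at h4
  rw [e]
  have h5 := h3.fderiv
  have h6 := congrArg (fun l : (Fin m → ℝ) →L[ℝ] ℝ => l (Pi.single j 1)) h5
  refine Eq.trans h6 ?_
  simp only [_root_.add_apply, _root_.smul_apply,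
    _root_.sum_apply, ContinuousLinearMap.proj_apply, smul_eq_mul] at h4 ⊢
  rw [h4, Pi.single_apply, show p - 1 - 1 = p - 2 by ring]
  split_ifs <;> ring

lemma trace_bound {m : ℕ} (hm : 1 ≤ m) {μ : Fin m → ℝ} (hμ : ∀ i, 0 < μ i) {δ : ℝ} (h0 : 0 < δ)
    (h1 : δ ≤ 1) {p : ℝ} (hp : 1 < p) (A : Matrix (Fin m) (Fin m) ℝ) (x : Fin m → ℝ) :
    traceHess m A (Vpd m μ δ p) x ≤ (∑ i, ∑ j, |A i j|) *
      (p * (p-1) * (1 / ⨅ i, μ i)^2 * GG m μ δ x ^ (p-2)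
        + p * GG m μ δ x ^ (p-1) * (3 * δ^2 * (1 / ⨅ i, μ i))) := by
  unfold traceHess
  set L := 1 / ⨅ i, μ i with hL
  have hL0 : 0 < L := by rw [hL]; have := iInf_mu_pos hm hμ; positivity
  have hpos := GG_pos hm hμ h0 h1
  have hW : 0 < GG m μ δ x ^ (p-1) := Real.rpow_pos_of_pos (hpos x) _
  have hl : 0 < GG m μ δ x ^ (p-2) := Real.rpow_pos_of_pos (hpos x) _
  rw [Finset.sum_mul]
  refine Finset.sum_le_sum fun i _ => ?_
  rw [Finset.sum_mul]
  refine Finset.sum_le_sum fun j _ => ?_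
  rw [hess_Vpd hpos]
  refine (le_abs_self _).trans ?_
  rw [abs_mul]
  refine mul_le_mul_of_nonneg_left ?_ (abs_nonneg _)
  have hd : ∀ k, |dphi δ (x k) / μ k| ≤ L := fun k => by
    rw [abs_div, abs_of_pos (hμ k), div_eq_mul_one_div]
    have a := abs_dphi h0 h1 (x k)
    have b := inv_mu_le hm hμ k
    have c : 0 < 1 / μ k := by have := hμ k; positivity
    calc _ ≤ 1 * (1 / μ k) := mul_le_mul_of_nonneg_right (a.trans h1) c.le
      _ ≤ L := by rw [one_mul]; exact b
  have hdd : |if i = j then ddphi δ (x i) / μ i else 0| ≤ 3 * δ^2 * L := by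
    split_ifs
    · rw [abs_div, abs_of_pos (hμ i), div_eq_mul_one_div]
      have c : 0 < 1 / μ i := by have := hμ i; positivity
      exact mul_le_mul (abs_ddphi δ (x i)) (inv_mu_le hm hμ i) c.le (by positivity)
    · rw [abs_zero]; positivity
  have hpp : 0 ≤ p * (p-1) * GG m μ δ x ^ (p-2) :=
    mul_nonneg (mul_nonneg (by linarith) (by linarith)) hl.le
  have hpW : 0 ≤ p * GG m μ δ x ^ (p-1) := mul_nonneg (by linarith) hW.le
  refine (abs_add_le _ _).trans (add_le_add ?_ ?_)
  · rw [abs_mul, abs_mul, abs_of_nonneg hpp, mul_assoc]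
    calc _ ≤ (p * (p-1) * GG m μ δ x ^ (p-2)) * (L * L) :=
          mul_le_mul_of_nonneg_left (mul_le_mul (hd j) (hd i) (abs_nonneg _) hL0.le) hpp
      _ = _ := by ring
  · rw [abs_mul, abs_of_nonneg hpW]
    exact mul_le_mul_of_nonneg_left hdd hpW

/-! ### Drift estimates -/

lemma dGG_drift_le {m : ℕ} {μ γ : Fin m → ℝ} (hμ : ∀ i, 0 < μ i) (hγ : ∀ i, 0 ≤ γ i)
    {β : ℝ} {δ : ℝ} (h0 : 0 < δ) (h1 : δ ≤ 1)
    (hc : ∀ i, δ * (γ i / μ i) ≤ 1) (x u : Fin m → ℝ) (hu : ∀ i, 0 ≤ u i) (hu1 : ∑ i, u i = 1) :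
    dGG m μ δ x (drift m μ γ β x u) ≤
      ∑ i, dphi δ (x i) * (-(β / m)) + ∑ i, dphi δ (x i) * (-(x i)) + δ * max (∑ j, x j) 0 := by
  set S := max (∑ j, x j) 0 with hS
  have hS0 : 0 ≤ S := le_max_right _ _
  have e : δ * S = ∑ i, δ * S * u i := by rw [← Finset.mul_sum, hu1, mul_one]
  rw [e, ← Finset.sum_add_distrib, ← Finset.sum_add_distrib]
  unfold dGG drift
  refine Finset.sum_le_sum fun i _ => ?_
  rw [← hS]
  have hmi := hμ i
  have e2 : dphi δ (x i) / μ i * (-(β / m) * μ i - μ i * (x i - S * u i) - S * (γ i * u i)) =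
      dphi δ (x i) * (-(β / m)) + dphi δ (x i) * (-(x i)) +
        (dphi δ (x i) * (1 - γ i / μ i)) * (S * u i) := by
    field_simp
    ring
  rw [e2]
  have := mul_le_mul_of_nonneg_right
    (dphi_mul_c h0 h1 (div_nonneg (hγ i) hmi.le) (hc i) (x i)) (mul_nonneg hS0 (hu i))
  linarith

lemma drift_pos {m : ℕ} (hm : 1 ≤ m) {μ γ : Fin m → ℝ} (hμ : ∀ i, 0 < μ i) (hγ : ∀ i, 0 ≤ γ i)
    {β : ℝ} (hβ : 0 < β) {δ : ℝ} (h0 : 0 < δ) (h1 : δ ≤ 1)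
    (hc : ∀ i, δ * (γ i / μ i) ≤ 1) (x u : Fin m → ℝ) (hu : ∀ i, 0 ≤ u i) (hu1 : ∑ i, u i = 1)
    (hS : 0 < ∑ j, x j) :
    dGG m μ δ x (drift m μ γ β x u) ≤ -(δ * (β / m)) + δ^2 * (β + m) := by
  refine (dGG_drift_le hμ hγ h0 h1 hc x u hu hu1).trans ?_
  rw [max_eq_left hS.le]
  have hm0 : (0:ℝ) < m := by exact_mod_cast hm
  have hbm : 0 < β / m := by positivity
  have b : ∑ i, dphi δ (x i) * (-(x i)) ≤ -(δ * ∑ j, x j) + m * δ^2 := by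
    calc _ ≤ ∑ i, (-(δ * x i) + δ^2) := Finset.sum_le_sum fun i _ => dphi_mul_1 h0 (x i)
      _ = _ := by
        rw [Finset.sum_add_distrib, Finset.sum_neg_distrib, ← Finset.mul_sum]; simp
  have a : ∑ i, dphi δ (x i) * (-(β / m)) ≤ δ^2 * β - δ * (β / m) := by
    obtain ⟨k, -, hk⟩ := Finset.exists_lt_of_sum_lt (s := Finset.univ) (f := fun _ => (0:ℝ))
      (g := x) (by simpa using hS)
    have hsum : 1 ≤ ∑ i, dpsi (δ * x i) := by
      have h := Finset.single_le_sum (f := fun i => dpsi (δ * x i))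
        (fun i _ => dpsi_nonneg _) (Finset.mem_univ k)
      rwa [dpsi_of_nonneg (mul_nonneg h0.le hk.le)] at h
    have hsum2 : ∑ i, dpsi (-(x i)) ≤ m := by
      calc _ ≤ ∑ i : Fin m, (1:ℝ) := Finset.sum_le_sum fun i _ => dpsi_le_one _
        _ = _ := by simp
    rw [← Finset.sum_mul]
    have e : ∑ i, dphi δ (x i) = δ * ∑ i, dpsi (δ * x i) - δ^2 * ∑ i, dpsi (-(x i)) := by
      unfold dphi
      rw [Finset.sum_sub_distrib, Finset.mul_sum, Finset.mul_sum]
    have hlow : δ - δ^2 * m ≤ ∑ i, dphi δ (x i) := by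
      rw [e]
      have h2 : 0 ≤ δ^2 := sq_nonneg δ
      nlinarith
    have := mul_le_mul_of_nonneg_right hlow hbm.le
    have e3 : δ^2 * m * (β / m) = δ^2 * β := by field_simp
    linarith
  linarith

lemma drift_neg {m : ℕ} (hm : 1 ≤ m) {μ γ : Fin m → ℝ} (hμ : ∀ i, 0 < μ i) (hγ : ∀ i, 0 ≤ γ i)
    {β : ℝ} (hβ : 0 < β) {δ : ℝ} (h0 : 0 < δ) (h1 : δ ≤ 1)
    (hc : ∀ i, δ * (γ i / μ i) ≤ 1) (x u : Fin m → ℝ) (hu : ∀ i, 0 ≤ u i) (hu1 : ∑ i, u i = 1)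
    (hS : ∑ j, x j ≤ 0) :
    dGG m μ δ x (drift m μ γ β x u) ≤ β + 2 * m - δ^2 * ∑ i, |x i| := by
  refine (dGG_drift_le hμ hγ h0 h1 hc x u hu hu1).trans ?_
  rw [max_eq_right hS]
  have hm0 : (0:ℝ) < m := by exact_mod_cast hm
  have hbm : 0 < β / m := by positivity
  have b : ∑ i, dphi δ (x i) * (-(x i)) ≤ 2 * m - δ^2 * ∑ i, |x i| := by
    calc _ ≤ ∑ i, (2 - δ^2 * |x i|) := Finset.sum_le_sum fun i _ => by
            have := dphi_mul_2 h0 h1 (x i)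
            nlinarith
      _ = _ := by
        rw [Finset.sum_sub_distrib, ← Finset.mul_sum]; simp; ring
  have a : ∑ i, dphi δ (x i) * (-(β / m)) ≤ β := by
    calc _ ≤ ∑ i : Fin m, (β / m) := Finset.sum_le_sum fun i _ => by
            have := (abs_le.mp (abs_dphi h0 h1 (x i))).1
            nlinarith
      _ = _ := by simp; field_simp
  linarith

/-! ### Jump estimates -/

lemma eucNorm_continuous (m : ℕ) : Continuous (eucNorm m) := by
  unfold eucNorm
  fun_prop

lemma eucNorm_nonneg (m : ℕ) (y : Fin m → ℝ) : 0 ≤ eucNorm m y := Real.sqrt_nonneg _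

lemma abs_le_eucNorm (m : ℕ) (y : Fin m → ℝ) (i : Fin m) : |y i| ≤ eucNorm m y := by
  unfold eucNorm
  rw [← Real.sqrt_sq_eq_abs]
  exact Real.sqrt_le_sqrt
    (Finset.single_le_sum (f := fun i => y i ^ 2) (fun i _ => sq_nonneg _) (Finset.mem_univ i))

lemma integrable_moment {m : ℕ} {η : Measure (Fin m → ℝ)} (hη : IsFiniteMeasure η)
    {p : ℝ} (hp : 1 < p)
    (hmom : Integrable (fun y => eucNorm m y ^ p) (η.restrict {y | 1 < eucNorm m y})) :
    Integrable (fun y => (1 + eucNorm m y) ^ p) η := by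
  have hms : MeasurableSet {y | 1 < eucNorm m y} :=
    (isOpen_lt continuous_const (eucNorm_continuous m)).measurableSet
  have h1 : Integrable ({y | 1 < eucNorm m y}.indicator (fun y => eucNorm m y ^ p)) η :=
    (integrable_indicator_iff hms).mpr hmom
  have h2 : Integrable (fun y => (2:ℝ)^p *
      (1 + {y | 1 < eucNorm m y}.indicator (fun y => eucNorm m y ^ p) y)) η :=
    ((integrable_const (1:ℝ)).add h1).const_mul _
  refine h2.mono' ?_ ?_
  · refine Continuous.aestronglyMeasurable ?_
    exact (continuous_const.add (eucNorm_continuous m)).rpow_const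
      (fun y => Or.inr (by linarith))
  · refine Filter.Eventually.of_forall fun y => ?_
    have hN := eucNorm_nonneg m y
    have h2p : (0:ℝ) < 2^p := Real.rpow_pos_of_pos (by norm_num) _
    rw [Real.norm_of_nonneg (Real.rpow_nonneg (by linarith) _)]
    by_cases hy : 1 < eucNorm m y
    · rw [Set.indicator_of_mem (by exact hy)]
      have : (1 + eucNorm m y)^p ≤ (2 * eucNorm m y)^p :=
        Real.rpow_le_rpow (by linarith) (by linarith) (by linarith)
      rw [Real.mul_rpow (by norm_num) hN] at this
      linarith
    · rw [Set.indicator_of_notMem (by exact hy)]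
      push Not at hy
      have : (1 + eucNorm m y)^p ≤ 2^p :=
        Real.rpow_le_rpow (by linarith) (by linarith) (by linarith)
      linarith

lemma GG_diff {m : ℕ} (hm : 1 ≤ m) {μ : Fin m → ℝ} (hμ : ∀ i, 0 < μ i) {δ : ℝ} (h0 : 0 < δ)
    (h1 : δ ≤ 1) (x y : Fin m → ℝ) :
    |GG m μ δ (x + y) - GG m μ δ x| ≤ m * (1 / ⨅ i, μ i) * eucNorm m y := by
  have e : GG m μ δ (x + y) - GG m μ δ x = ∑ i, (phi δ (x i + y i) - phi δ (x i)) / μ i := by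
    unfold GG
    rw [add_sub_add_right_eq_sub, ← Finset.sum_sub_distrib]
    refine Finset.sum_congr rfl fun i _ => ?_
    rw [Pi.add_apply, sub_div]
  rw [e]
  refine (Finset.abs_sum_le_sum_abs _ _).trans ?_
  calc _ ≤ ∑ i : Fin m, (1 / ⨅ i, μ i) * eucNorm m y := Finset.sum_le_sum fun i _ => ?_
    _ = _ := by rw [Finset.sum_const, Finset.card_univ, Fintype.card_fin, nsmul_eq_mul, mul_assoc]
  rw [abs_div, abs_of_pos (hμ i), div_eq_mul_one_div, mul_comm]
  have c : 0 < 1 / μ i := by have := hμ i; positivity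
  have hb := inv_mu_le hm hμ i
  refine mul_le_mul hb ?_ (abs_nonneg _) (c.le.trans hb)
  refine (phi_lip h0 h1 (x i) (y i)).trans ?_
  have := abs_le_eucNorm m y i
  have := abs_nonneg (y i)
  nlinarith

lemma GG_taylor {m : ℕ} (hm : 1 ≤ m) {μ : Fin m → ℝ} (hμ : ∀ i, 0 < μ i) {δ s p : ℝ} (h0 : 0 < δ)
    (h1 : δ ≤ 1) (hs0 : 0 ≤ s) (hs1 : s ≤ 1) (hsp : 1 + s ≤ p) (x y : Fin m → ℝ) :
    GG m μ δ (x + y) - GG m μ δ x - dGG m μ δ x y ≤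
      m * (1 / ⨅ i, μ i) * (3 * δ^(1+s)) * (1 + eucNorm m y)^p := by
  have e : GG m μ δ (x + y) - GG m μ δ x - dGG m μ δ x y =
      ∑ i, (phi δ (x i + y i) - phi δ (x i) - dphi δ (x i) * y i) / μ i := by
    unfold GG dGG
    rw [add_sub_add_right_eq_sub, ← Finset.sum_sub_distrib, ← Finset.sum_sub_distrib]
    refine Finset.sum_congr rfl fun i _ => ?_
    rw [Pi.add_apply]; ring
  rw [e]
  calc _ ≤ ∑ i : Fin m, (1 / ⨅ i, μ i) * ((3 * δ^(1+s)) * (1 + eucNorm m y)^p) :=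
        Finset.sum_le_sum fun i _ => ?_
    _ = _ := by
      rw [Finset.sum_const, Finset.card_univ, Fintype.card_fin, nsmul_eq_mul]; ring
  have c : 0 < 1 / μ i := by have := hμ i; positivity
  have hb := inv_mu_le hm hμ i
  have hN := eucNorm_nonneg m y
  have hd : 0 < δ^(1+s) := Real.rpow_pos_of_pos h0 _
  have ht := (le_abs_self _).trans (phi_taylor h0 h1 hs0 hs1 (x i) (y i))
  have hy : |y i|^(1+s) ≤ (1 + eucNorm m y)^p := by
    have hyi := abs_le_eucNorm m y i
    calc _ ≤ (1 + eucNorm m y)^(1+s) :=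
          Real.rpow_le_rpow (abs_nonneg _) (by linarith) (by linarith)
      _ ≤ _ := Real.rpow_le_rpow_of_exponent_le (by linarith) hsp
  have hT : phi δ (x i + y i) - phi δ (x i) - dphi δ (x i) * y i ≤
      (3 * δ^(1+s)) * (1 + eucNorm m y)^p :=
    ht.trans (mul_le_mul_of_nonneg_left hy (by positivity))
  have hT0 : 0 ≤ (3 * δ^(1+s)) * (1 + eucNorm m y)^p :=
    mul_nonneg (by positivity) (Real.rpow_nonneg (by linarith) _)
  rw [div_eq_mul_one_div, mul_comm]
  calc _ ≤ (1 / μ i) * ((3 * δ^(1+s)) * (1 + eucNorm m y)^p) :=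
        mul_le_mul_of_nonneg_left hT c.le
    _ ≤ _ := mul_le_mul_of_nonneg_right hb hT0

lemma jump_bound {m : ℕ} (hm : 1 ≤ m) {μ : Fin m → ℝ} (hμ : ∀ i, 0 < μ i)
    {η : Measure (Fin m → ℝ)} {p s : ℝ} (hp : 1 < p) (hs0 : 0 ≤ s) (hs1 : s ≤ 1)
    (hsp : 1 + s ≤ p)
    (hI : Integrable (fun y => (1 + eucNorm m y) ^ p) η) :
    ∃ C : ℝ, 0 ≤ C ∧ ∀ δ : ℝ, 0 < δ → δ ≤ 1 → ∀ x,
      Jeta m η (Vpd m μ δ p) x ≤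
        (C * (GG m μ δ x ^ (p-2) + 1) +
          p * GG m μ δ x ^ (p-1) * (m * (1 / ⨅ i, μ i) * (3 * δ^(1+s)))) *
          ∫ y, (1 + eucNorm m y) ^ p ∂η := by
  obtain ⟨C, hC0, hC⟩ := pow_rem hp (g0_pos hm hμ)
  have hL0 : 0 < 1 / ⨅ i, μ i := by have := iInf_mu_pos hm hμ; positivity
  have hm0 : (0:ℝ) < m := by exact_mod_cast hm
  set L := 1 / ⨅ i, μ i with hL
  have hk : 0 ≤ (1 + m * L)^p := Real.rpow_nonneg (by positivity) _
  refine ⟨C * (1 + m * L)^p, mul_nonneg hC0 hk, fun δ h0 h1 x => ?_⟩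
  have hpos := GG_pos hm hμ h0 h1
  have hW : 0 < GG m μ δ x ^ (p-1) := Real.rpow_pos_of_pos (hpos x) _
  have hl : 0 < GG m μ δ x ^ (p-2) := Real.rpow_pos_of_pos (hpos x) _
  have hd : 0 < δ^(1+s) := Real.rpow_pos_of_pos h0 _
  have hp0 : 0 < p := by linarith
  rw [← integral_const_mul]
  unfold Jeta
  set Q := C * (1 + m * L)^p * (GG m μ δ x ^ (p-2) + 1) +
          p * GG m μ δ x ^ (p-1) * (m * L * (3 * δ^(1+s))) with hQ
  have hQ0 : 0 ≤ Q := by positivity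
  have hpt : ∀ y, Vpd m μ δ p (x + y) - Vpd m μ δ p x - fderiv ℝ (Vpd m μ δ p) x y ≤
      Q * (1 + eucNorm m y) ^ p := by
    intro y
    have hN := eucNorm_nonneg m y
    rw [fderiv_Vpd (hpos x), Vpd_eq, Vpd_eq]
    have a := hC (GG m μ δ (x+y)) (GG m μ δ x) (GG_ge hm hμ h0 h1 _) (GG_ge hm hμ h0 h1 _)
    have b := GG_taylor hm hμ h0 h1 hs0 hs1 hsp x y
    rw [← hL] at b
    have b' := mul_le_mul_of_nonneg_left b (mul_nonneg hp0.le hW.le)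
    have c : (1 + |GG m μ δ (x+y) - GG m μ δ x|)^p ≤ (1 + m * L)^p * (1 + eucNorm m y)^p := by
      rw [← Real.mul_rpow (by positivity) (by linarith)]
      refine Real.rpow_le_rpow (by positivity) ?_ hp0.le
      have h := GG_diff hm hμ h0 h1 x y
      rw [← hL] at h
      have : 0 ≤ m * L := by positivity
      nlinarith
    have c' := mul_le_mul_of_nonneg_left c
      (show 0 ≤ C * (GG m μ δ x ^ (p-2) + 1) by positivity)
    rw [hQ]
    linarith
  by_cases hint : Integrable (fun y => Vpd m μ δ p (x + y) - Vpd m μ δ p x -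
      fderiv ℝ (Vpd m μ δ p) x y) η
  · exact integral_mono hint (hI.const_mul Q) hpt
  · rw [integral_undef hint]
    exact integral_nonneg fun y => mul_nonneg hQ0
      (Real.rpow_nonneg (by have := eucNorm_nonneg m y; linarith) _)

lemma exists_delta {m : ℕ} (c : Fin m → ℝ) {s Q κ : ℝ} (hs : 0 < s) (hκ : 0 < κ) :
    ∃ δ : ℝ, 0 < δ ∧ δ ≤ 1 ∧ δ^s * Q ≤ κ ∧ ∀ i, δ * c i ≤ 1 := by
  have t1 : Filter.Tendsto (fun δ : ℝ => δ^s * Q) (nhdsWithin 0 (Set.Ioi 0)) (nhds 0) := by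
    have h : Continuous (fun δ : ℝ => δ^s * Q) :=
      (continuous_id.rpow_const (fun _ => Or.inr hs.le)).mul continuous_const
    have := h.tendsto 0
    rw [Real.zero_rpow hs.ne', zero_mul] at this
    exact this.mono_left nhdsWithin_le_nhds
  have t2 : ∀ i, ∀ᶠ δ : ℝ in nhdsWithin 0 (Set.Ioi 0), δ * c i ≤ 1 := by
    intro i
    have h : Continuous (fun δ : ℝ => δ * c i) := continuous_id.mul continuous_const
    have := h.tendsto 0
    rw [zero_mul] at this
    exact (this.mono_left nhdsWithin_le_nhds).eventually_le_const one_pos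
  have t3 : ∀ᶠ δ : ℝ in nhdsWithin 0 (Set.Ioi 0), δ ≤ 1 :=
    ((continuous_id.tendsto (0:ℝ)).mono_left nhdsWithin_le_nhds).eventually_le_const one_pos
  obtain ⟨δ, hδ⟩ := ((t1.eventually_le_const hκ).and
    ((Filter.eventually_all.mpr t2).and (t3.and self_mem_nhdsWithin))).exists
  exact ⟨δ, hδ.2.2.2, hδ.2.2.1, hδ.1, hδ.2.1⟩

/-- Theorem 5(a): assume `β̃ > 0`, `η` a finite Borel measure with
`∫_{|y|>1} |y|^p η(dy) < ∞` and `p > 1`. Then there exist `δ ∈ (0,1]`, `C̃₀ > 0`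
and a compact `K` such that
`ℒ^u 𝒱_{p,δ}(x) + 𝔍_η 𝒱_{p,δ}(x) ≤ C̃₀ 1_K(x) - pδ (β̃/(2m)) 𝒱_{p-1,δ}(x)`
for all `x ∈ ℝ^m` and `u ∈ Δ`. -/
theorem stmt_16 (m : ℕ) (hm : 1 ≤ m) (μ γ : Fin m → ℝ)
    (hμ : ∀ i, 0 < μ i) (hγ : ∀ i, 0 ≤ γ i)
    (βt : ℝ) (hβ : 0 < βt)
    (σ : Matrix (Fin m) (Fin m) ℝ)
    (η : Measure (Fin m → ℝ)) (hη : IsFiniteMeasure η)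
    (p : ℝ) (hp : 1 < p)
    (hmom : Integrable (fun y => eucNorm m y ^ p)
      (η.restrict {y | 1 < eucNorm m y})) :
    ∃ δ : ℝ, 0 < δ ∧ δ ≤ 1 ∧ ∃ C : ℝ, 0 < C ∧ ∃ K : Set (Fin m → ℝ), IsCompact K ∧
      ∀ x u : Fin m → ℝ, (∀ i, 0 ≤ u i) → ∑ i, u i = 1 →
        (1 / 2) * traceHess m (σ * σ.transpose) (Vpd m μ δ p) x
            + fderiv ℝ (Vpd m μ δ p) x (drift m μ γ βt x u)
            + Jeta m η (Vpd m μ δ p) x ≤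
          K.indicator (fun _ => C) x
            - p * δ * (βt / (2 * (m : ℝ))) * Vpd m μ δ (p - 1) x := by
  have hm0 : (0:ℝ) < m := by exact_mod_cast hm
  have hp0 : 0 < p := by linarith
  have hL0 : 0 < 1 / ⨅ i, μ i := by have := iInf_mu_pos hm hμ; positivity
  have hg0 := g0_pos hm hμ
  obtain ⟨s, hs0, hs1, hsp⟩ : ∃ s : ℝ, 0 < s ∧ s ≤ 1 ∧ 1 + s ≤ p :=
    ⟨min (p-1) 1, lt_min (by linarith) one_pos, min_le_right _ _, by
      have := min_le_left (p-1) 1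
      linarith⟩
  have hI := integrable_moment hη hp hmom
  obtain ⟨C, hC0, hJ⟩ := jump_bound hm hμ hp hs0.le hs1 hsp hI
  set A := σ * σ.transpose with hA
  obtain ⟨a, ha⟩ : ∃ a, a = ∑ i, ∑ j, |A i j| := ⟨_, rfl⟩
  have ha0 : 0 ≤ a := by
    rw [ha]; exact Finset.sum_nonneg fun i _ => Finset.sum_nonneg fun j _ => abs_nonneg _
  obtain ⟨I, hIe⟩ : ∃ I, I = ∫ y, (1 + eucNorm m y) ^ p ∂η := ⟨_, rfl⟩
  have hI0 : 0 ≤ I := by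
    rw [hIe]
    exact integral_nonneg fun y =>
      Real.rpow_nonneg (by have := eucNorm_nonneg m y; linarith) _
  rw [← hIe] at hJ
  have hT := fun (δ : ℝ) (h0 : 0 < δ) (h1 : δ ≤ 1) (x : Fin m → ℝ) =>
    trace_bound hm hμ h0 h1 hp A x
  rw [← ha] at hT
  obtain ⟨L, hL⟩ : ∃ L, L = 1 / ⨅ i, μ i := ⟨_, rfl⟩
  rw [← hL] at hJ hT hL0
  have hQ' : 0 ≤ 3 * a * L + 3 * m * L * I := by positivity
  obtain ⟨Q', hQe⟩ : ∃ Q', Q' = 3 * a * L + 3 * m * L * I := ⟨_, rfl⟩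
  rw [← hQe] at hQ'
  obtain ⟨δ, h0, h1, hδQ, hδc⟩ := exists_delta (fun i => γ i / μ i)
    (Q := βt + m + Q') (κ := βt / m / 4) hs0 (by positivity)
  have hC3 : 0 ≤ a * p * (p-1) * L^2 + C * I := by
    have : 0 ≤ p - 1 := by linarith
    positivity
  obtain ⟨C3, hC3e⟩ : ∃ C3, C3 = a * p * (p-1) * L^2 + C * I := ⟨_, rfl⟩
  rw [← hC3e] at hC3
  have hbm : 0 < βt / m := by positivity
  obtain ⟨b, hb⟩ : ∃ b, b = βt / m := ⟨_, rfl⟩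
  obtain ⟨B0, hB0⟩ := low_order hp (ε := p * δ * (βt / m) / 4 / (C3 + 1)) (by positivity)
  have hpos := GG_pos hm hμ h0 h1
  have hd1 : δ^(1+s) = δ * δ^s := by rw [Real.rpow_add h0, Real.rpow_one]
  have hds : 0 < δ^s := Real.rpow_pos_of_pos h0 _
  have hds1 : δ^s ≤ 1 := Real.rpow_le_one h0.le h1 hs0.le
  have hd2 : δ^2 ≤ δ^(1+s) := by
    rw [← Real.rpow_two]
    exact Real.rpow_le_rpow_of_exponent_ge h0 h1 (by linarith)
  have hd3 : δ^(1+s) ≤ 1 := by rw [hd1]; nlinarith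
  have hdpos : 0 < δ^(1+s) := Real.rpow_pos_of_pos h0 _
  -- the total bound
  have htot : ∀ x u : Fin m → ℝ,
      (1 / 2) * traceHess m A (Vpd m μ δ p) x
            + fderiv ℝ (Vpd m μ δ p) x (drift m μ γ βt x u)
            + Jeta m η (Vpd m μ δ p) x ≤
      p * GG m μ δ x ^ (p-1) * (dGG m μ δ x (drift m μ γ βt x u) + δ^(1+s) * Q')
        + C3 * (GG m μ δ x ^ (p-2) + 1) := by
    intro x u
    have hW : 0 < GG m μ δ x ^ (p-1) := Real.rpow_pos_of_pos (hpos x) _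
    have hl : 0 < GG m μ δ x ^ (p-2) := Real.rpow_pos_of_pos (hpos x) _
    have j := hJ δ h0 h1 x
    have t := hT δ h0 h1 x
    rw [fderiv_Vpd (hpos x)]
    generalize dGG m μ δ x (drift m μ γ βt x u) = D at *
    generalize GG m μ δ x ^ (p-1) = W at *
    generalize GG m μ δ x ^ (p-2) = l at *
    have hp1 : 0 ≤ p - 1 := by linarith
    have t0 : 0 ≤ a * (p * (p-1) * L^2 * l + p * W * (3 * δ^2 * L)) := by positivity
    have t1 : (1/2) * traceHess m A (Vpd m μ δ p) x ≤
        a * (p * (p-1) * L^2 * l + p * W * (3 * δ^2 * L)) := by linarith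
    have t2 : a * (p * W * (3 * δ^2 * L)) ≤ a * (p * W * (3 * δ^(1+s) * L)) := by gcongr
    have t3 : 0 ≤ a * p * (p-1) * L^2 := by positivity
    rw [hQe, hC3e]
    linarith
  have hDpos : ∀ x u : Fin m → ℝ, (∀ i, 0 ≤ u i) → ∑ i, u i = 1 → 0 < ∑ j, x j →
      dGG m μ δ x (drift m μ γ βt x u) ≤ -(δ * (βt / m)) + δ^(1+s) * (βt + m) := by
    intro x u hu hu1 hS
    refine (drift_pos hm hμ hγ hβ h0 h1 hδc x u hu hu1 hS).trans ?_
    have := mul_le_mul_of_nonneg_right hd2 (show 0 ≤ βt + m by positivity)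
    linarith
  have hDneg := fun (x u : Fin m → ℝ) (hu : ∀ i, 0 ≤ u i) (hu1 : ∑ i, u i = 1)
    (hS : ∑ j, x j ≤ 0) => drift_neg hm hμ hγ hβ h0 h1 hδc x u hu hu1 hS
  have hsmu : 0 ≤ ∑ i, μ i := Finset.sum_nonneg fun i _ => (hμ i).le
  have hR0 : 0 ≤ (βt + 2 * m + βt / m + |B0| * ∑ i, μ i) / δ^2 := by positivity
  obtain ⟨R, hR⟩ : ∃ R, R = (βt + 2 * m + βt / m + |B0| * ∑ i, μ i) / δ^2 := ⟨_, rfl⟩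
  rw [← hR] at hR0
  have hRd : δ^2 * R = βt + 2 * m + βt / m + |B0| * ∑ i, μ i := by
    rw [hR]; field_simp
  obtain ⟨G1, hG1⟩ : ∃ G1, G1 = ∑ i, 2 * R / μ i + (m : ℝ) / ⨅ i, μ i := ⟨_, rfl⟩
  obtain ⟨g0, hg0e⟩ : ∃ g0, g0 = (m : ℝ) / (⨅ i, μ i) / 2 := ⟨_, rfl⟩
  rw [← hg0e] at hg0
  have hG10 : 0 ≤ G1 := by
    rw [hG1]
    have : 0 ≤ ∑ i, 2 * R / μ i := Finset.sum_nonneg fun i _ => by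
      have := hμ i
      positivity
    linarith
  have hW10 : 0 ≤ G1^(p-1) := Real.rpow_nonneg hG10 _
  refine ⟨δ, h0, h1, p * G1^(p-1) * (2 * βt + 3 * m + Q' + βt / m)
    + C3 * (G1^(p-1) / g0 + 1) + 1, by positivity, Metric.closedBall 0 R,
    isCompact_closedBall 0 R, fun x u hu hu1 => ?_⟩
  refine (htot x u).trans ?_
  rw [Vpd_eq, show βt / (2 * (m:ℝ)) = (βt / m) / 2 by ring]
  have hW : 0 < GG m μ δ x ^ (p-1) := Real.rpow_pos_of_pos (hpos x) _
  have hl : 0 < GG m μ δ x ^ (p-2) := Real.rpow_pos_of_pos (hpos x) _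
  by_cases hx : x ∈ Metric.closedBall (0 : Fin m → ℝ) R
  · rw [Set.indicator_of_mem hx]
    rw [mem_closedBall_zero_iff, pi_norm_le_iff_of_nonneg hR0] at hx
    have hGle : GG m μ δ x ≤ G1 := by
      rw [hG1]; unfold GG
      have : ∑ i, phi δ (x i) / μ i ≤ ∑ i, 2 * R / μ i := Finset.sum_le_sum fun i _ => by
        have h := hx i
        rw [Real.norm_eq_abs] at h
        exact div_le_div_of_nonneg_right
          ((phi_upper h0 h1 (x i)).trans (by linarith)) (hμ i).le
      linarith
    have hWle : GG m μ δ x ^ (p-1) ≤ G1^(p-1) :=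
      Real.rpow_le_rpow (hpos x).le hGle (by linarith)
    have hlle : GG m μ δ x ^ (p-2) ≤ G1^(p-1) / g0 := by
      have e : GG m μ δ x ^ (p-1) = GG m μ δ x ^ (p-2) * GG m μ δ x := by
        rw [← Real.rpow_add_one (hpos x).ne']; congr 1; ring
      rw [le_div_iff₀ hg0]
      have hge := GG_ge hm hμ h0 h1 x
      rw [← hg0e] at hge
      nlinarith
    have hD : dGG m μ δ x (drift m μ γ βt x u) ≤ 2 * βt + 3 * m := by
      rcases lt_or_ge 0 (∑ j, x j) with hS | hS
      · refine (hDpos x u hu hu1 hS).trans ?_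
        have : δ^(1+s) * (βt + m) ≤ 1 * (βt + m) :=
          mul_le_mul_of_nonneg_right hd3 (by positivity)
        have : 0 ≤ δ * (βt / m) := by positivity
        linarith
      · refine (hDneg x u hu hu1 hS).trans ?_
        have : 0 ≤ δ^2 * ∑ i, |x i| :=
          mul_nonneg (sq_nonneg _) (Finset.sum_nonneg fun i _ => abs_nonneg _)
        linarith
    generalize dGG m μ δ x (drift m μ γ βt x u) = D at *
    generalize GG m μ δ x ^ (p-1) = W at *
    generalize GG m μ δ x ^ (p-2) = l at *
    have q1 : δ^(1+s) * Q' ≤ 1 * Q' := mul_le_mul_of_nonneg_right hd3 hQ'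
    have q2 : δ * (βt / m) ≤ 1 * (βt / m) := mul_le_mul_of_nonneg_right h1 hbm.le
    have q3 : 0 ≤ δ * (βt / m) := by positivity
    have q4 : p * W * (D + δ^(1+s) * Q' + δ * (βt / m) / 2) ≤
        p * W * (2 * βt + 3 * m + Q' + βt / m) :=
      mul_le_mul_of_nonneg_left (by linarith) (by positivity)
    have q5 : p * W * (2 * βt + 3 * m + Q' + βt / m) ≤
        p * G1^(p-1) * (2 * βt + 3 * m + Q' + βt / m) := by gcongr
    have q6 : C3 * (l + 1) ≤ C3 * (G1^(p-1) / g0 + 1) := by gcongr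
    linarith
  · rw [Set.indicator_of_notMem hx]
    rw [mem_closedBall_zero_iff, pi_norm_le_iff_of_nonneg hR0] at hx
    push Not at hx
    obtain ⟨i, hi⟩ := hx
    rw [Real.norm_eq_abs] at hi
    have hGB : B0 ≤ GG m μ δ x := by
      have h := GG_lower hm hμ h0 h1 x
      rw [← hg0e] at h
      have h2 := Finset.single_le_sum (f := fun i => δ^2 * |x i| / μ i) (fun i _ => by
        have := hμ i
        positivity) (Finset.mem_univ i)
      have h3 : |B0| ≤ δ^2 * |x i| / μ i := by
        rw [le_div_iff₀ (hμ i)]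
        have h4 : μ i ≤ ∑ i, μ i :=
          Finset.single_le_sum (f := μ) (fun i _ => (hμ i).le) (Finset.mem_univ i)
        have h5 : |B0| * μ i ≤ |B0| * ∑ i, μ i := mul_le_mul_of_nonneg_left h4 (abs_nonneg _)
        have h6 : δ^2 * R ≤ δ^2 * |x i| := mul_le_mul_of_nonneg_left hi.le (sq_nonneg _)
        linarith
      have := le_abs_self B0
      linarith
    have hlow := hB0 _ hGB
    have hD : dGG m μ δ x (drift m μ γ βt x u) ≤ -(δ * (βt / m)) + δ^(1+s) * (βt + m) := by
      rcases lt_or_ge 0 (∑ j, x j) with hS | hS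
      · exact hDpos x u hu hu1 hS
      · refine (hDneg x u hu hu1 hS).trans ?_
        have h2 := Finset.single_le_sum (f := fun i => |x i|) (fun i _ => abs_nonneg _)
          (Finset.mem_univ i)
        have h6 : δ^2 * R ≤ δ^2 * ∑ i, |x i| :=
          mul_le_mul_of_nonneg_left (hi.le.trans h2) (sq_nonneg _)
        have h7 : 0 ≤ |B0| * ∑ i, μ i := by positivity
        have h8 : δ * (βt / m) ≤ 1 * (βt / m) := mul_le_mul_of_nonneg_right h1 hbm.le
        have h9 : 0 ≤ δ^(1+s) * (βt + m) := by positivity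
        linarith
    generalize dGG m μ δ x (drift m μ γ βt x u) = D at *
    generalize GG m μ δ x ^ (p-1) = W at *
    generalize GG m μ δ x ^ (p-2) = l at *
    have q1 : δ^(1+s) * (βt + m + Q') ≤ δ * (βt / m / 4) := by
      rw [hd1, mul_assoc]
      exact mul_le_mul_of_nonneg_left hδQ h0.le
    have q2 : p * W * (D + δ^(1+s) * Q') ≤ p * W * (-(3/4) * (δ * (βt / m))) :=
      mul_le_mul_of_nonneg_left (by linarith) (by positivity)
    have q3 : C3 * (l + 1) ≤ p * δ * (βt / m) / 4 * W := by
      have h : (C3 + 1) * (l + 1) ≤ (C3 + 1) * (p * δ * (βt / m) / 4 / (C3 + 1) * W) :=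
        mul_le_mul_of_nonneg_left hlow (by positivity)
      have e : (C3 + 1) * (p * δ * (βt / m) / 4 / (C3 + 1) * W) = p * δ * (βt / m) / 4 * W := by
        field_simp
      rw [e] at h
      linarith
    linarith

end
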